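/- Let σ1, σ2 > 0, ρ ∈ (−1,1), α1 ∈ (−1,0) and α2 ∈ (0,2] with α1 + α2 > 1. Then E[|X1|^{α1}|X2|^{α2}] − E[|X1|^{α1}]·E[|X2|^{α2}] ≥ (2^{(α1+α2)/2} α1 α2 σ1^{α1} σ2^{α2} ρ² / (2π)) · Γ((α1+1)/2) · Γ((α2+1)/2) · [Γ(3/2)·Γ((α1+α2−1)/2) / (Γ((α1+1)/2)·Γ((α2+1)/2))]. (The bracketed quantity equals the value F(1−α1/2, 1−α2/2; 3/2; 1) of the Gauss hypergeometric series at 1, by Gauss's summation theorem.) -/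

import Mathlib

open MeasureTheory Real

/-- Centered bivariate Gaussian density with variances σ₁², σ₂² and correlation ρ. -/
noncomputable def gaussDensity2 (σ₁ σ₂ ρ x y : ℝ) : ℝ :=
  (2 * π * σ₁ * σ₂ * Real.sqrt (1 - ρ ^ 2))⁻¹ *
    Real.exp (-(x ^ 2 / σ₁ ^ 2 - 2 * ρ * x * y / (σ₁ * σ₂) + y ^ 2 / σ₂ ^ 2) /
      (2 * (1 - ρ ^ 2)))

/-- E[|X₁|^a |X₂|^b] for the centered bivariate Gaussian. -/
noncomputable def E2 (σ₁ σ₂ ρ a b : ℝ) : ℝ :=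
  ∫ q : ℝ × ℝ, |q.1| ^ a * |q.2| ^ b * gaussDensity2 σ₁ σ₂ ρ q.1 q.2

/-- E[|X|^a] for a centered Gaussian with variance σ². -/
noncomputable def E1 (σ a : ℝ) : ℝ :=
  ∫ x : ℝ, |x| ^ a * (Real.sqrt (2 * π * σ ^ 2))⁻¹ * Real.exp (-x ^ 2 / (2 * σ ^ 2))

open scoped ENNReal

theorem lintegral_rpow_mul_exp_neg_mul {s r : ℝ} (hs : 0 < s) (hr : 0 < r) :
    ∫⁻ t in Set.Ioi (0 : ℝ), ENNReal.ofReal (t ^ (s - 1) * exp (-(r * t))) =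
      ENNReal.ofReal (r ^ (-s) * Gamma s) := by
  have hval := integral_rpow_mul_exp_neg_mul_Ioi hs hr
  have hpos : 0 < (1 / r) ^ s * Gamma s :=
    mul_pos (rpow_pos_of_pos (by positivity) _) (Gamma_pos_of_pos hs)
  have hint : Integrable (fun t : ℝ => t ^ (s - 1) * exp (-(r * t)))
      (volume.restrict (Set.Ioi 0)) := by
    by_contra h
    rw [integral_undef h] at hval
    exact hpos.ne hval
  rw [← ofReal_integral_eq_lintegral_ofReal hint, hval, one_div, inv_rpow hr.le, rpow_neg hr.le]
  filter_upwards [ae_restrict_mem measurableSet_Ioi] with t ht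
  have : (0 : ℝ) < t := ht
  positivity

theorem lintegral_rpow_mul_add_mul_rpow_neg {p r A c : ℝ} (hp : 0 < p) (hpr : p < r)
    (hA : 0 < A) (hc : 0 < c) :
    ∫⁻ u in Set.Ioi (0 : ℝ), ENNReal.ofReal (u ^ (p - 1) * (A + c * u) ^ (-r)) =
      ENNReal.ofReal (c ^ (-p) * A ^ (p - r) * Gamma p * Gamma (r - p) / Gamma r) := by
  have hr : 0 < r := hp.trans hpr
  have hΓ := Gamma_pos_of_pos hr
  have hΓp := Gamma_pos_of_pos hp
  have hrep : ∀ u ∈ Set.Ioi (0 : ℝ),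
      ENNReal.ofReal (u ^ (p - 1) * (A + c * u) ^ (-r)) =
        ∫⁻ t in Set.Ioi (0 : ℝ), ENNReal.ofReal
          ((Gamma r)⁻¹ * (u ^ (p - 1) * exp (-(c * t * u))) *
            (t ^ (r - 1) * exp (-(A * t)))) := by
    intro u hu
    have hu : 0 < u := hu
    have h := lintegral_rpow_mul_exp_neg_mul (r := A + c * u) hr (by positivity)
    have e : ∀ t : ℝ, ENNReal.ofReal
          ((Gamma r)⁻¹ * (u ^ (p - 1) * exp (-(c * t * u))) *
            (t ^ (r - 1) * exp (-(A * t)))) = ENNReal.ofReal ((Gamma r)⁻¹ * u ^ (p - 1)) *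
              ENNReal.ofReal (t ^ (r - 1) * exp (-((A + c * u) * t))) := by
      intro t
      rw [← ENNReal.ofReal_mul (by positivity)]
      congr 1
      rw [show -((A + c * u) * t) = -(c * t * u) + -(A * t) by ring, exp_add]
      ring
    simp_rw [e]
    rw [lintegral_const_mul _ (by fun_prop), h, ← ENNReal.ofReal_mul (by positivity)]
    congr 1
    field_simp
  rw [setLIntegral_congr_fun measurableSet_Ioi hrep, lintegral_lintegral_swap (by fun_prop)]
  have hin : ∀ t ∈ Set.Ioi (0 : ℝ),
      ∫⁻ u in Set.Ioi (0 : ℝ), ENNReal.ofReal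
          ((Gamma r)⁻¹ * (u ^ (p - 1) * exp (-(c * t * u))) *
            (t ^ (r - 1) * exp (-(A * t)))) =
      ENNReal.ofReal ((Gamma r)⁻¹ * c ^ (-p) * Gamma p) *
        ENNReal.ofReal (t ^ (r - p - 1) * exp (-(A * t))) := by
    intro t ht
    have ht : 0 < t := ht
    have h := lintegral_rpow_mul_exp_neg_mul (r := c * t) hp (by positivity)
    have e : ∀ u : ℝ, ENNReal.ofReal
          ((Gamma r)⁻¹ * (u ^ (p - 1) * exp (-(c * t * u))) *
            (t ^ (r - 1) * exp (-(A * t)))) =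
          ENNReal.ofReal ((Gamma r)⁻¹ * (t ^ (r - 1) * exp (-(A * t)))) *
              ENNReal.ofReal (u ^ (p - 1) * exp (-(c * t * u))) := by
      intro u
      rw [← ENNReal.ofReal_mul (by positivity)]
      congr 1
      ring
    simp_rw [e]
    rw [lintegral_const_mul _ (by fun_prop), h, ← ENNReal.ofReal_mul (by positivity),
      ← ENNReal.ofReal_mul (by positivity)]
    congr 1
    rw [mul_rpow hc.le ht.le, show r - p - 1 = (r - 1) + (-p) by ring, rpow_add ht]
    ring
  rw [setLIntegral_congr_fun measurableSet_Ioi hin, lintegral_const_mul _ (by fun_prop),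
    lintegral_rpow_mul_exp_neg_mul (sub_pos.2 hpr) hA, ← ENNReal.ofReal_mul (by positivity)]
  congr 1
  rw [neg_sub]
  field_simp

theorem lintegral_rpow_mul_one_sub_exp {b : ℝ} (hb : 0 < b) (hb2 : b < 2) (y : ℝ) :
    ∫⁻ v in Set.Ioi (0 : ℝ), ENNReal.ofReal (v ^ (-b / 2 - 1) * (1 - exp (-(v * y ^ 2)))) =
      ENNReal.ofReal (2 / b * Gamma (1 - b / 2) * |y| ^ b) := by
  have hΓ := Gamma_pos_of_pos (show 0 < 1 - b / 2 by linarith)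
  have hrep : ∀ v ∈ Set.Ioi (0 : ℝ),
      ENNReal.ofReal (v ^ (-b / 2 - 1) * (1 - exp (-(v * y ^ 2)))) =
        ∫⁻ s in Set.Ioc 0 (y ^ 2), ENNReal.ofReal (v ^ (1 - b / 2 - 1) * exp (-(s * v))) := by
    intro v hv
    have hv : 0 < v := hv
    have hi : Integrable (fun s : ℝ => v ^ (1 - b / 2 - 1) * exp (-(s * v)))
        (volume.restrict (Set.Ioc 0 (y ^ 2))) :=
      (Continuous.integrableOn_Ioc (by fun_prop))
    rw [← ofReal_integral_eq_lintegral_ofReal hi (ae_of_all _ fun s => by positivity),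
      ← intervalIntegral.integral_of_le (sq_nonneg y)]
    congr 1
    have hd : ∀ s ∈ Set.uIcc 0 (y ^ 2), HasDerivAt
        (fun s : ℝ => -(v ^ (-b / 2 - 1) * exp (-(s * v))))
        (v ^ (1 - b / 2 - 1) * exp (-(s * v))) s := by
      intro s _
      refine ((((hasDerivAt_id' s).mul_const v).fun_neg.exp.const_mul
        (v ^ (-b / 2 - 1))).fun_neg).congr_deriv ?_
      rw [show 1 - b / 2 - 1 = (-b / 2 - 1) + 1 by ring, rpow_add_one hv.ne']
      ring
    rw [intervalIntegral.integral_eq_sub_of_hasDerivAt hd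
      (Continuous.intervalIntegrable (by fun_prop) _ _)]
    rw [zero_mul, neg_zero, exp_zero, mul_comm (y ^ 2)]
    ring
  rw [setLIntegral_congr_fun measurableSet_Ioi hrep, lintegral_lintegral_swap (by fun_prop)]
  have hin : ∀ s ∈ Set.Ioc (0 : ℝ) (y ^ 2),
      ∫⁻ v in Set.Ioi (0 : ℝ), ENNReal.ofReal (v ^ (1 - b / 2 - 1) * exp (-(s * v))) =
      ENNReal.ofReal (Gamma (1 - b / 2) * s ^ (b / 2 - 1)) := by
    intro s hs
    rw [lintegral_rpow_mul_exp_neg_mul (by linarith) hs.1, neg_sub, mul_comm]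
  rw [setLIntegral_congr_fun measurableSet_Ioc hin]
  have hii : IntervalIntegrable (fun s : ℝ => Gamma (1 - b / 2) * s ^ (b / 2 - 1)) volume
      0 (y ^ 2) := (intervalIntegral.intervalIntegrable_rpow' (by linarith)).const_mul _
  rw [← ofReal_integral_eq_lintegral_ofReal
      ((intervalIntegrable_iff_integrableOn_Ioc_of_le (sq_nonneg y)).1 hii),
    ← intervalIntegral.integral_of_le (sq_nonneg y), intervalIntegral.integral_const_mul,
    integral_rpow (Or.inl (by linarith))]
  · congr 1
    rw [sub_add_cancel, zero_rpow (by positivity), ← sq_abs, ← rpow_natCast,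
      ← rpow_mul (abs_nonneg y), show ((2 : ℕ) : ℝ) * (b / 2) = b by push_cast; ring]
    field_simp
    ring
  · filter_upwards [ae_restrict_mem measurableSet_Ioc] with s hs
    have := hs.1
    positivity

theorem lintegral_exp_neg_quadratic {α β γ : ℝ} (hγ : 0 < γ) (hdet : 0 < α * γ - β ^ 2) :
    ∫⁻ q : ℝ × ℝ, ENNReal.ofReal
        (exp (-(α * q.1 ^ 2 - 2 * β * q.1 * q.2 + γ * q.2 ^ 2))) =
      ENNReal.ofReal (π / √(α * γ - β ^ 2)) := by
  have gauss : ∀ {c : ℝ}, 0 < c →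
      ∫⁻ y : ℝ, ENNReal.ofReal (exp (-c * y ^ 2)) = ENNReal.ofReal (√(π / c)) := by
    intro c hc
    rw [← ofReal_integral_eq_lintegral_ofReal (integrable_exp_neg_mul_sq hc)
      (ae_of_all _ fun y => (exp_pos _).le), integral_gaussian]
  have hδ : 0 < (α * γ - β ^ 2) / γ := by positivity
  rw [Measure.volume_eq_prod, lintegral_prod _ (by fun_prop)]
  have hin : ∀ x : ℝ, ∫⁻ y : ℝ, ENNReal.ofReal
      (exp (-(α * x ^ 2 - 2 * β * x * y + γ * y ^ 2))) =
      ENNReal.ofReal (exp (-((α * γ - β ^ 2) / γ) * x ^ 2)) * ENNReal.ofReal (√(π / γ)) := by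
    intro x
    rw [← gauss hγ, ← lintegral_sub_right_eq_self
      (fun y => ENNReal.ofReal (exp (-γ * y ^ 2))) (β * x / γ),
      ← lintegral_const_mul _ (by fun_prop)]
    refine lintegral_congr fun y => ?_
    rw [← ENNReal.ofReal_mul (exp_pos _).le, ← exp_add]
    congr 2
    field_simp
    ring
  simp_rw [hin]
  rw [lintegral_mul_const _ (by fun_prop), gauss hδ, ← ENNReal.ofReal_mul (by positivity),
    ← sqrt_mul (by positivity)]
  congr 1
  rw [show π / ((α * γ - β ^ 2) / γ) * (π / γ) = π ^ 2 / (α * γ - β ^ 2) by field_simp,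
    sqrt_div (by positivity), sqrt_sq pi_pos.le]

theorem gaussDensity2_nonneg {σ₁ σ₂ : ℝ} (hσ₁ : 0 < σ₁) (hσ₂ : 0 < σ₂) (ρ x y : ℝ) :
    0 ≤ gaussDensity2 σ₁ σ₂ ρ x y := by
  unfold gaussDensity2
  positivity

theorem measurable_gaussDensity2 (σ₁ σ₂ ρ : ℝ) :
    Measurable fun q : ℝ × ℝ => gaussDensity2 σ₁ σ₂ ρ q.1 q.2 := by
  unfold gaussDensity2
  fun_prop

theorem lintegral_exp_mul_gaussDensity2 {σ₁ σ₂ ρ u v : ℝ} (hσ₁ : 0 < σ₁) (hσ₂ : 0 < σ₂)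
    (hρ : ρ ^ 2 < 1) (hu : 0 ≤ u) (hv : 0 ≤ v) :
    ∫⁻ q : ℝ × ℝ, ENNReal.ofReal
        (exp (-(u * q.1 ^ 2)) * exp (-(v * q.2 ^ 2)) * gaussDensity2 σ₁ σ₂ ρ q.1 q.2) =
      ENNReal.ofReal (1 / √((1 + 2 * (u * σ₁ ^ 2)) * (1 + 2 * (v * σ₂ ^ 2)) -
        4 * (u * σ₁ ^ 2) * (v * σ₂ ^ 2) * ρ ^ 2)) := by
  have h1 : 0 < 1 - ρ ^ 2 := by linarith
  set α := 1 / (2 * (1 - ρ ^ 2) * σ₁ ^ 2) + u with hα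
  set β := ρ / (2 * (1 - ρ ^ 2) * (σ₁ * σ₂)) with hβ
  set γ := 1 / (2 * (1 - ρ ^ 2) * σ₂ ^ 2) + v with hγ
  have hD : 0 < (1 + 2 * (u * σ₁ ^ 2)) * (1 + 2 * (v * σ₂ ^ 2)) -
        4 * (u * σ₁ ^ 2) * (v * σ₂ ^ 2) * ρ ^ 2 := by
    have : 0 < 1 + 2 * (u * σ₁ ^ 2) + 2 * (v * σ₂ ^ 2) +
      4 * (u * σ₁ ^ 2) * (v * σ₂ ^ 2) * (1 - ρ ^ 2) := by positivity
    linarith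
  have hγ0 : 0 < γ := by positivity
  have hdet : (2 * σ₁ * σ₂) ^ 2 * (1 - ρ ^ 2) * (α * γ - β ^ 2) =
      (1 + 2 * (u * σ₁ ^ 2)) * (1 + 2 * (v * σ₂ ^ 2)) -
        4 * (u * σ₁ ^ 2) * (v * σ₂ ^ 2) * ρ ^ 2 := by
    rw [hα, hβ, hγ]
    field_simp
    ring
  have hdet0 : 0 < α * γ - β ^ 2 := by
    rw [← hdet] at hD
    exact pos_of_mul_pos_right hD (by positivity)
  have e : ∀ q : ℝ × ℝ, ENNReal.ofReal
        (exp (-(u * q.1 ^ 2)) * exp (-(v * q.2 ^ 2)) * gaussDensity2 σ₁ σ₂ ρ q.1 q.2) =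
      ENNReal.ofReal ((2 * π * σ₁ * σ₂ * √(1 - ρ ^ 2))⁻¹) *
      ENNReal.ofReal (exp (-(α * q.1 ^ 2 - 2 * β * q.1 * q.2 + γ * q.2 ^ 2))) := by
    intro q
    rw [← ENNReal.ofReal_mul (by positivity), gaussDensity2, mul_left_comm, ← exp_add, ← exp_add]
    congr 3
    rw [hα, hβ, hγ]
    field_simp
    ring
  simp_rw [e]
  rw [lintegral_const_mul _ (by fun_prop), lintegral_exp_neg_quadratic hγ0 hdet0,
    ← ENNReal.ofReal_mul (by positivity), ← hdet, sqrt_mul (by positivity),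
    sqrt_mul (by positivity), sqrt_sq (by positivity)]
  congr 1
  field_simp

theorem inv_sqrt_sub_inv_sqrt_le {A B z : ℝ} (hB : 0 ≤ B) (hAB : 0 < A - B) (hz : 0 ≤ z)
    (hz1 : z ≤ 1) :
    1 / √(A - B * z) - 1 / √A ≤ B * z / 2 * (A - B) ^ (-(3 / 2 : ℝ)) := by
  have hBz : B * z ≤ B := mul_le_of_le_one_right hB hz1
  have hBz0 : 0 ≤ B * z := mul_nonneg hB hz
  have hw2 : 0 < A - B * z := by linarith
  have hA : 0 < A := by linarith
  have hc : 0 < √(A - B) := sqrt_pos.2 hAB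
  have hcw : √(A - B) ≤ √(A - B * z) := sqrt_le_sqrt (by linarith)
  have hca : √(A - B) ≤ √A := sqrt_le_sqrt (by linarith)
  have hpow : (A - B) ^ (-(3 / 2 : ℝ)) = 1 / √(A - B) ^ 3 := by
    rw [rpow_neg hAB.le, sqrt_eq_rpow, ← rpow_natCast, ← rpow_mul hAB.le, one_div]
    norm_num
  have hw := sq_sqrt hw2.le
  have ha := sq_sqrt hA.le
  rw [hpow]
  generalize √(A - B) = c at *
  generalize √(A - B * z) = w at *
  generalize √A = a at *
  have hw0 : 0 < w := hc.trans_le hcw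
  have ha0 : 0 < a := hc.trans_le hca
  have hdiff : 1 / w - 1 / a = B * z / (w * a * (a + w)) := by
    field_simp
    linarith
  rw [hdiff, show B * z / 2 * (1 / c ^ 3) = B * z / (c * c * (c + c)) by field_simp; ring]
  gcongr

/-- `E[|X₁|^a (1 - exp (-v X₂²))]` for the centered bivariate Gaussian, as a lower integral. -/
noncomputable def oneSubExpMoment (σ₁ σ₂ ρ a v : ℝ) : ℝ≥0∞ :=
  ∫⁻ q : ℝ × ℝ, ENNReal.ofReal
    (|q.1| ^ a * (1 - exp (-(v * q.2 ^ 2))) * gaussDensity2 σ₁ σ₂ ρ q.1 q.2)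

/-- `E[|X₁|^a |X₂|^b]` for the centered bivariate Gaussian, as a lower integral. -/
noncomputable def absMoment (σ₁ σ₂ ρ a b : ℝ) : ℝ≥0∞ :=
  ∫⁻ q : ℝ × ℝ, ENNReal.ofReal (|q.1| ^ a * |q.2| ^ b * gaussDensity2 σ₁ σ₂ ρ q.1 q.2)

theorem one_sub_exp_neg_mul_sq_nonneg {v : ℝ} (hv : 0 ≤ v) (y : ℝ) :
    0 ≤ 1 - exp (-(v * y ^ 2)) :=
  sub_nonneg.2 (exp_le_one_iff.2 (neg_nonpos.2 (by positivity)))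

theorem lintegral_exp_mul_one_sub_exp_mul_gaussDensity2 {σ₁ σ₂ ρ u v : ℝ} (hσ₁ : 0 < σ₁)
    (hσ₂ : 0 < σ₂) (hρ : ρ ^ 2 < 1) (hu : 0 ≤ u) (hv : 0 ≤ v) :
    ∫⁻ q : ℝ × ℝ, ENNReal.ofReal
        (exp (-(u * q.1 ^ 2)) * (1 - exp (-(v * q.2 ^ 2))) * gaussDensity2 σ₁ σ₂ ρ q.1 q.2) =
      ENNReal.ofReal (1 / √(1 + 2 * (u * σ₁ ^ 2)) -
        1 / √((1 + 2 * (u * σ₁ ^ 2)) * (1 + 2 * (v * σ₂ ^ 2)) -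
        4 * (u * σ₁ ^ 2) * (v * σ₂ ^ 2) * ρ ^ 2)) := by
  have h0 := lintegral_exp_mul_gaussDensity2 hσ₁ hσ₂ hρ hu le_rfl
  have hv' := lintegral_exp_mul_gaussDensity2 hσ₁ hσ₂ hρ hu hv
  have hm := measurable_gaussDensity2 σ₁ σ₂ ρ
  simp only [zero_mul, neg_zero, exp_zero, mul_one, mul_zero, add_zero, sub_zero] at h0
  rw [ENNReal.ofReal_sub _ (by positivity), ← h0, ← hv', ← lintegral_sub (by fun_prop)]
  · refine lintegral_congr fun q => ?_
    have := gaussDensity2_nonneg hσ₁ hσ₂ ρ q.1 q.2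
    rw [← ENNReal.ofReal_sub _ (by positivity)]
    congr 1
    ring
  · rw [hv']
    exact ENNReal.ofReal_ne_top
  · refine ae_of_all _ fun q => ENNReal.ofReal_le_ofReal ?_
    have := gaussDensity2_nonneg hσ₁ hσ₂ ρ q.1 q.2
    have h1 := one_sub_exp_neg_mul_sq_nonneg hv q.2
    refine mul_le_mul_of_nonneg_right ?_ this
    exact mul_le_of_le_one_right (exp_pos _).le (by linarith)

theorem oneSubExpMoment_eq_lintegral {σ₁ σ₂ ρ a v : ℝ} (hσ₁ : 0 < σ₁) (hσ₂ : 0 < σ₂)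
    (hρ : ρ ^ 2 < 1) (ha : a < 0) (hv : 0 ≤ v) :
    oneSubExpMoment σ₁ σ₂ ρ a v =
      ∫⁻ u in Set.Ioi (0 : ℝ), ENNReal.ofReal ((Gamma (-a / 2))⁻¹ * u ^ (-a / 2 - 1)) *
        ENNReal.ofReal (1 / √(1 + 2 * (u * σ₁ ^ 2)) -
          1 / √((1 + 2 * (u * σ₁ ^ 2)) * (1 + 2 * (v * σ₂ ^ 2)) -
          4 * (u * σ₁ ^ 2) * (v * σ₂ ^ 2) * ρ ^ 2)) := by
  have hs : 0 < -a / 2 := by linarith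
  have hΓ := Gamma_pos_of_pos hs
  have hm := measurable_gaussDensity2 σ₁ σ₂ ρ
  have hne : ∀ᵐ q : ℝ × ℝ, q.1 ≠ 0 :=
    Measure.quasiMeasurePreserving_fst.ae (Measure.ae_ne volume (0 : ℝ))
  have hrep : ∀ᵐ q : ℝ × ℝ, ENNReal.ofReal
      (|q.1| ^ a * (1 - exp (-(v * q.2 ^ 2))) * gaussDensity2 σ₁ σ₂ ρ q.1 q.2) =
      ∫⁻ u in Set.Ioi (0 : ℝ), ENNReal.ofReal ((Gamma (-a / 2))⁻¹ * u ^ (-a / 2 - 1)) *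
        ENNReal.ofReal (exp (-(u * q.1 ^ 2)) * (1 - exp (-(v * q.2 ^ 2))) *
          gaussDensity2 σ₁ σ₂ ρ q.1 q.2) := by
    filter_upwards [hne] with q hq
    have hp := gaussDensity2_nonneg hσ₁ hσ₂ ρ q.1 q.2
    have h1 := one_sub_exp_neg_mul_sq_nonneg hv q.2
    have e : ∀ u ∈ Set.Ioi (0 : ℝ),
        ENNReal.ofReal ((Gamma (-a / 2))⁻¹ * u ^ (-a / 2 - 1)) *
          ENNReal.ofReal (exp (-(u * q.1 ^ 2)) * (1 - exp (-(v * q.2 ^ 2))) *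
            gaussDensity2 σ₁ σ₂ ρ q.1 q.2) =
        ENNReal.ofReal ((Gamma (-a / 2))⁻¹ * (1 - exp (-(v * q.2 ^ 2))) *
            gaussDensity2 σ₁ σ₂ ρ q.1 q.2) *
          ENNReal.ofReal (u ^ (-a / 2 - 1) * exp (-(q.1 ^ 2 * u))) := by
      intro u hu
      have hu : 0 < u := hu
      rw [← ENNReal.ofReal_mul (by positivity), ← ENNReal.ofReal_mul (by positivity)]
      congr 1
      rw [mul_comm (q.1 ^ 2)]
      ring
    rw [setLIntegral_congr_fun measurableSet_Ioi e, lintegral_const_mul _ (by fun_prop),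
      lintegral_rpow_mul_exp_neg_mul hs (by positivity), ← ENNReal.ofReal_mul (by positivity)]
    congr 1
    rw [← sq_abs q.1, ← rpow_natCast |q.1|, ← rpow_mul (abs_nonneg _),
      show ((2 : ℕ) : ℝ) * (-(-a / 2)) = a by push_cast; ring]
    generalize Gamma (-a / 2) = g at *
    field_simp
  rw [oneSubExpMoment, lintegral_congr_ae hrep, lintegral_lintegral_swap (by fun_prop)]
  refine setLIntegral_congr_fun measurableSet_Ioi fun u hu => ?_
  have hu : 0 < u := hu
  rw [lintegral_const_mul _ (by fun_prop),
    lintegral_exp_mul_one_sub_exp_mul_gaussDensity2 hσ₁ hσ₂ hρ hu.le hv]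

theorem oneSubExpMoment_le_uncorrelated {σ₁ σ₂ ρ a v : ℝ} (hσ₁ : 0 < σ₁) (hσ₂ : 0 < σ₂)
    (hρ : ρ ^ 2 < 1) (ha : a < 0) (hv : 0 ≤ v) :
    oneSubExpMoment σ₁ σ₂ ρ a v ≤ oneSubExpMoment σ₁ σ₂ 0 a v := by
  rw [oneSubExpMoment_eq_lintegral hσ₁ hσ₂ hρ ha hv,
    oneSubExpMoment_eq_lintegral hσ₁ hσ₂ (by norm_num) ha hv]
  refine setLIntegral_mono' measurableSet_Ioi fun u hu => ?_
  have hu : 0 < u := hu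
  have h1 : 0 ≤ (u * σ₁ ^ 2) * (v * σ₂ ^ 2) * (1 - ρ ^ 2) :=
    mul_nonneg (by positivity) (by linarith)
  have h2 : 0 ≤ u * σ₁ ^ 2 := by positivity
  have h3 : 0 ≤ v * σ₂ ^ 2 := by positivity
  refine mul_le_mul_right (ENNReal.ofReal_le_ofReal (sub_le_sub_left
    (one_div_le_one_div_of_le (sqrt_pos.2 (by nlinarith)) (sqrt_le_sqrt ?_)) _)) _
  nlinarith [mul_nonneg (mul_nonneg h2 h3) (sq_nonneg ρ)]

theorem oneSubExpMoment_uncorrelated_le {σ₁ σ₂ ρ a v : ℝ} (hσ₁ : 0 < σ₁) (hσ₂ : 0 < σ₂)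
    (hρ : ρ ^ 2 < 1) (ha : a < 0) (ha1 : -1 < a) (hv : 0 ≤ v) :
    oneSubExpMoment σ₁ σ₂ 0 a v ≤ oneSubExpMoment σ₁ σ₂ ρ a v +
      ENNReal.ofReal (ρ ^ 2 * v * (-a * σ₂ ^ 2 * σ₁ ^ a * 2 ^ (a / 2 - 1) * Gamma ((a + 1) / 2) /
        Gamma (3 / 2)) * (1 + 2 * σ₂ ^ 2 * v) ^ (-((a + 1) / 2))) := by
  have hs : 0 < -a / 2 := by linarith
  have hΓ := Gamma_pos_of_pos hs
  have hbeta := lintegral_rpow_mul_add_mul_rpow_neg (p := 1 - a / 2) (r := 3 / 2)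
    (A := 1 + 2 * σ₂ ^ 2 * v) (c := 2 * σ₁ ^ 2) (by linarith) (by linarith)
    (by positivity) (by positivity)
  have herr : ENNReal.ofReal (ρ ^ 2 * v * (-a * σ₂ ^ 2 * σ₁ ^ a * 2 ^ (a / 2 - 1) *
        Gamma ((a + 1) / 2) / Gamma (3 / 2)) * (1 + 2 * σ₂ ^ 2 * v) ^ (-((a + 1) / 2))) =
      ∫⁻ u in Set.Ioi (0 : ℝ),
        ENNReal.ofReal ((Gamma (-a / 2))⁻¹ * (2 * σ₁ ^ 2 * (v * σ₂ ^ 2) * ρ ^ 2)) *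
        ENNReal.ofReal (u ^ (1 - a / 2 - 1) *
          (1 + 2 * σ₂ ^ 2 * v + 2 * σ₁ ^ 2 * u) ^ (-(3 / 2 : ℝ))) := by
    rw [lintegral_const_mul _ (by fun_prop), hbeta, ← ENNReal.ofReal_mul (by positivity)]
    congr 1
    have hG : Gamma (1 - a / 2) = -a / 2 * Gamma (-a / 2) := by
      rw [← Gamma_add_one hs.ne']
      ring_nf
    rw [hG, show (3 / 2 : ℝ) - (1 - a / 2) = (a + 1) / 2 by ring,
      show 1 - a / 2 - (3 / 2 : ℝ) = -((a + 1) / 2) by ring,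
      mul_rpow (by norm_num) (by positivity), ← rpow_natCast σ₁ 2, ← rpow_mul hσ₁.le,
      show -(1 - a / 2) = a / 2 - 1 by ring,
      show a = ((2 : ℕ) : ℝ) + ((2 : ℕ) : ℝ) * (a / 2 - 1) by push_cast; ring, rpow_add hσ₁]
    rw [show ((2 : ℕ) : ℝ) + ((2 : ℕ) : ℝ) * (a / 2 - 1) = a by push_cast; ring]
    have := Gamma_pos_of_pos (show (0 : ℝ) < 3 / 2 by norm_num)
    generalize Gamma (-a / 2) = g at *
    field_simp
  rw [oneSubExpMoment_eq_lintegral hσ₁ hσ₂ (by norm_num) ha hv,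
    oneSubExpMoment_eq_lintegral hσ₁ hσ₂ hρ ha hv, herr,
    ← lintegral_add_right _ (by fun_prop)]
  refine setLIntegral_mono' measurableSet_Ioi fun u hu => ?_
  have hu : 0 < u := hu
  have h2 : 0 ≤ u * σ₁ ^ 2 := by positivity
  have h3 : 0 ≤ v * σ₂ ^ 2 := by positivity
  have key := inv_sqrt_sub_inv_sqrt_le
    (A := (1 + 2 * (u * σ₁ ^ 2)) * (1 + 2 * (v * σ₂ ^ 2)))
    (B := 4 * (u * σ₁ ^ 2) * (v * σ₂ ^ 2)) (z := ρ ^ 2) (by positivity) (by nlinarith)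
    (sq_nonneg ρ) hρ.le
  rw [show (1 + 2 * (u * σ₁ ^ 2)) * (1 + 2 * (v * σ₂ ^ 2)) - 4 * (u * σ₁ ^ 2) * (v * σ₂ ^ 2) =
    1 + 2 * σ₂ ^ 2 * v + 2 * σ₁ ^ 2 * u by ring] at key
  have hsplit : ENNReal.ofReal ((Gamma (-a / 2))⁻¹ * (2 * σ₁ ^ 2 * (v * σ₂ ^ 2) * ρ ^ 2)) *
        ENNReal.ofReal (u ^ (1 - a / 2 - 1) *
          (1 + 2 * σ₂ ^ 2 * v + 2 * σ₁ ^ 2 * u) ^ (-(3 / 2 : ℝ))) =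
      ENNReal.ofReal ((Gamma (-a / 2))⁻¹ * u ^ (-a / 2 - 1)) *
        ENNReal.ofReal (4 * (u * σ₁ ^ 2) * (v * σ₂ ^ 2) * ρ ^ 2 / 2 *
          (1 + 2 * σ₂ ^ 2 * v + 2 * σ₁ ^ 2 * u) ^ (-(3 / 2 : ℝ))) := by
    rw [← ENNReal.ofReal_mul (by positivity), ← ENNReal.ofReal_mul (by positivity)]
    congr 1
    rw [show 1 - a / 2 - 1 = (-a / 2 - 1) + 1 by ring, rpow_add_one hu.ne']
    ring
  rw [hsplit, ← mul_add]
  gcongr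
  refine (ENNReal.ofReal_le_ofReal ?_).trans ENNReal.ofReal_add_le
  simp only [ne_eq, OfNat.ofNat_ne_zero, not_false_eq_true, zero_pow, mul_zero, sub_zero]
  linarith

theorem absMoment_eq_lintegral {σ₁ σ₂ ρ a b : ℝ} (hσ₁ : 0 < σ₁) (hσ₂ : 0 < σ₂)
    (hb : 0 < b) (hb2 : b < 2) :
    absMoment σ₁ σ₂ ρ a b =
      ∫⁻ v in Set.Ioi (0 : ℝ), ENNReal.ofReal (b / 2 * (Gamma (1 - b / 2))⁻¹ * v ^ (-b / 2 - 1)) *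
        oneSubExpMoment σ₁ σ₂ ρ a v := by
  have hΓ := Gamma_pos_of_pos (show 0 < 1 - b / 2 by linarith)
  have hm := measurable_gaussDensity2 σ₁ σ₂ ρ
  have hrep : ∀ q : ℝ × ℝ, ENNReal.ofReal
      (|q.1| ^ a * |q.2| ^ b * gaussDensity2 σ₁ σ₂ ρ q.1 q.2) =
      ∫⁻ v in Set.Ioi (0 : ℝ), ENNReal.ofReal (b / 2 * (Gamma (1 - b / 2))⁻¹ * v ^ (-b / 2 - 1)) *
        ENNReal.ofReal (|q.1| ^ a * (1 - exp (-(v * q.2 ^ 2))) *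
          gaussDensity2 σ₁ σ₂ ρ q.1 q.2) := by
    intro q
    have hp := gaussDensity2_nonneg hσ₁ hσ₂ ρ q.1 q.2
    have e : ∀ v ∈ Set.Ioi (0 : ℝ),
        ENNReal.ofReal (b / 2 * (Gamma (1 - b / 2))⁻¹ * v ^ (-b / 2 - 1)) *
        ENNReal.ofReal (|q.1| ^ a * (1 - exp (-(v * q.2 ^ 2))) *
          gaussDensity2 σ₁ σ₂ ρ q.1 q.2) =
        ENNReal.ofReal (b / 2 * (Gamma (1 - b / 2))⁻¹ * |q.1| ^ a *
            gaussDensity2 σ₁ σ₂ ρ q.1 q.2) *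
          ENNReal.ofReal (v ^ (-b / 2 - 1) * (1 - exp (-(v * q.2 ^ 2)))) := by
      intro v hv
      have hv : 0 < v := hv
      rw [← ENNReal.ofReal_mul (by positivity), ← ENNReal.ofReal_mul (by positivity)]
      congr 1
      ring
    rw [setLIntegral_congr_fun measurableSet_Ioi e, lintegral_const_mul _ (by fun_prop),
      lintegral_rpow_mul_one_sub_exp hb hb2, ← ENNReal.ofReal_mul (by positivity)]
    congr 1
    generalize Gamma (1 - b / 2) = g at *
    field_simp
  simp_rw [absMoment, hrep]
  rw [lintegral_lintegral_swap (by fun_prop)]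
  refine lintegral_congr fun v => ?_
  rw [lintegral_const_mul _ (by fun_prop), oneSubExpMoment]

theorem absMoment_two_le_of_forall_oneSubExpMoment_le {σ₁ σ₂ ρ a : ℝ} {C : ℝ≥0∞}
    (h : ∀ v : ℝ, 0 < v → oneSubExpMoment σ₁ σ₂ ρ a v ≤ ENNReal.ofReal v * C) :
    absMoment σ₁ σ₂ ρ a 2 ≤ C := by
  have hm := measurable_gaussDensity2 σ₁ σ₂ ρ
  let v : ℕ → ℝ := fun n => 1 / ((n : ℝ) + 1)
  have hv : ∀ n, 0 < v n := fun n => by positivity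
  have hvt : Filter.Tendsto v Filter.atTop (nhdsWithin 0 (Set.Ioi 0)) :=
    tendsto_nhdsWithin_iff.2
      ⟨tendsto_one_div_add_atTop_nhds_zero_nat, Filter.Eventually.of_forall hv⟩
  let f : ℕ → ℝ × ℝ → ℝ≥0∞ := fun n q => ENNReal.ofReal (v n)⁻¹ * ENNReal.ofReal
    (|q.1| ^ a * (1 - exp (-(v n * q.2 ^ 2))) * gaussDensity2 σ₁ σ₂ ρ q.1 q.2)
  have hlim : ∀ q : ℝ × ℝ, Filter.liminf (fun n => f n q) Filter.atTop =
      ENNReal.ofReal (|q.1| ^ a * |q.2| ^ (2 : ℝ) * gaussDensity2 σ₁ σ₂ ρ q.1 q.2) := by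
    intro q
    refine Filter.Tendsto.liminf_eq ?_
    have hd : HasDerivAt (fun t : ℝ => 1 - exp (-(t * q.2 ^ 2))) (q.2 ^ 2) 0 := by
      refine (((hasDerivAt_id' (0 : ℝ)).mul_const (q.2 ^ 2)).fun_neg.exp.const_sub 1).congr_deriv ?_
      simp
    have ht := (hd.tendsto_slope_zero_right.comp hvt)
    have ht' := (ENNReal.continuous_ofReal.tendsto _).comp
      ((ht.const_mul (|q.1| ^ a)).mul_const (gaussDensity2 σ₁ σ₂ ρ q.1 q.2))
    rw [show |q.2| ^ (2 : ℝ) = q.2 ^ 2 by rw [rpow_two, sq_abs]]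
    refine ht'.congr fun n => ?_
    simp only [Function.comp, f]
    rw [← ENNReal.ofReal_mul (inv_nonneg.2 (hv n).le)]
    congr 1
    simp only [zero_add, smul_eq_mul, zero_mul, neg_zero, exp_zero, sub_self, sub_zero]
    ring
  calc absMoment σ₁ σ₂ ρ a 2 = ∫⁻ q, Filter.liminf (fun n => f n q) Filter.atTop := by
        simp_rw [hlim]
        rfl
    _ ≤ Filter.liminf (fun n => ∫⁻ q, f n q) Filter.atTop :=
        lintegral_liminf_le fun n => by fun_prop
    _ ≤ Filter.liminf (fun _ : ℕ => C) Filter.atTop := by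
        refine Filter.liminf_le_liminf (Filter.Eventually.of_forall fun n => ?_)
        calc ∫⁻ q, f n q = ENNReal.ofReal (v n)⁻¹ * oneSubExpMoment σ₁ σ₂ ρ a (v n) :=
              lintegral_const_mul _ (by fun_prop)
          _ ≤ ENNReal.ofReal (v n)⁻¹ * (ENNReal.ofReal (v n) * C) := by gcongr; exact h _ (hv n)
          _ = C := by
              rw [← mul_assoc, ← ENNReal.ofReal_mul (inv_nonneg.2 (hv n).le),
                inv_mul_cancel₀ (hv n).ne', ENNReal.ofReal_one, one_mul]
    _ = C := Filter.liminf_const C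

theorem oneSubExpMoment_le_absMoment_two {σ₁ σ₂ ρ a v : ℝ} (hσ₁ : 0 < σ₁) (hσ₂ : 0 < σ₂)
    (hv : 0 ≤ v) :
    oneSubExpMoment σ₁ σ₂ ρ a v ≤ ENNReal.ofReal v * absMoment σ₁ σ₂ ρ a 2 := by
  have hm := measurable_gaussDensity2 σ₁ σ₂ ρ
  rw [absMoment, ← lintegral_const_mul _ (by fun_prop)]
  refine lintegral_mono fun q => ?_
  rw [← ENNReal.ofReal_mul hv]
  refine ENNReal.ofReal_le_ofReal ?_
  have hp := gaussDensity2_nonneg hσ₁ hσ₂ ρ q.1 q.2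
  have h1 : 1 - exp (-(v * q.2 ^ 2)) ≤ v * q.2 ^ 2 := by
    linarith [add_one_le_exp (-(v * q.2 ^ 2))]
  calc |q.1| ^ a * (1 - exp (-(v * q.2 ^ 2))) * gaussDensity2 σ₁ σ₂ ρ q.1 q.2
      ≤ |q.1| ^ a * (v * q.2 ^ 2) * gaussDensity2 σ₁ σ₂ ρ q.1 q.2 := by gcongr
    _ = v * (|q.1| ^ a * |q.2| ^ (2 : ℝ) * gaussDensity2 σ₁ σ₂ ρ q.1 q.2) := by
        rw [rpow_two, sq_abs]
        ring

theorem absMoment_le_uncorrelated {σ₁ σ₂ ρ a b : ℝ} (hσ₁ : 0 < σ₁) (hσ₂ : 0 < σ₂)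
    (hρ : ρ ^ 2 < 1) (ha : a < 0) (hb : 0 < b) (hb2 : b ≤ 2) :
    absMoment σ₁ σ₂ ρ a b ≤ absMoment σ₁ σ₂ 0 a b := by
  rcases hb2.lt_or_eq with hb2 | rfl
  · rw [absMoment_eq_lintegral hσ₁ hσ₂ hb hb2, absMoment_eq_lintegral hσ₁ hσ₂ hb hb2]
    refine setLIntegral_mono' measurableSet_Ioi fun v hv => ?_
    gcongr
    exact oneSubExpMoment_le_uncorrelated hσ₁ hσ₂ hρ ha (le_of_lt hv)
  · exact absMoment_two_le_of_forall_oneSubExpMoment_le fun v hv =>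
      (oneSubExpMoment_le_uncorrelated hσ₁ hσ₂ hρ ha hv.le).trans
        (oneSubExpMoment_le_absMoment_two hσ₁ hσ₂ hv.le)

theorem absMoment_uncorrelated_le {σ₁ σ₂ ρ a b : ℝ} (hσ₁ : 0 < σ₁) (hσ₂ : 0 < σ₂)
    (hρ : ρ ^ 2 < 1) (ha : a < 0) (ha1 : -1 < a) (hb : 0 < b) (hb2 : b ≤ 2)
    (hab : 1 < a + b) :
    absMoment σ₁ σ₂ 0 a b ≤ absMoment σ₁ σ₂ ρ a b +
      ENNReal.ofReal (-(a * b * ρ ^ 2 * σ₁ ^ a * σ₂ ^ b * 2 ^ ((a + b) / 2) *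
        Gamma ((a + b - 1) / 2) / (8 * Gamma (3 / 2)))) := by
  have hΓ3 := Gamma_pos_of_pos (show (0 : ℝ) < 3 / 2 by norm_num)
  have hΓa := Gamma_pos_of_pos (show 0 < (a + 1) / 2 by linarith)
  rcases hb2.lt_or_eq with hb2 | rfl
  · have hΓ := Gamma_pos_of_pos (show 0 < 1 - b / 2 by linarith)
    have hτ : 0 ≤ -a * σ₂ ^ 2 * σ₁ ^ a * 2 ^ (a / 2 - 1) * Gamma ((a + 1) / 2) /
        Gamma (3 / 2) := by
      have : 0 < -a := by linarith
      positivity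
    set τ := -a * σ₂ ^ 2 * σ₁ ^ a * 2 ^ (a / 2 - 1) * Gamma ((a + 1) / 2) / Gamma (3 / 2) with hτdef
    have herr : ENNReal.ofReal (-(a * b * ρ ^ 2 * σ₁ ^ a * σ₂ ^ b * 2 ^ ((a + b) / 2) *
          Gamma ((a + b - 1) / 2) / (8 * Gamma (3 / 2)))) =
        ∫⁻ v in Set.Ioi (0 : ℝ), ENNReal.ofReal (b / 2 * (Gamma (1 - b / 2))⁻¹ * (ρ ^ 2 * τ)) *
          ENNReal.ofReal (v ^ (1 - b / 2 - 1) *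
            (1 + 2 * σ₂ ^ 2 * v) ^ (-((a + 1) / 2))) := by
      rw [lintegral_const_mul _ (by fun_prop), lintegral_rpow_mul_add_mul_rpow_neg (by linarith)
        (by linarith) one_pos (by positivity), ← ENNReal.ofReal_mul (by positivity)]
      congr 1
      rw [hτdef, show (a + 1) / 2 - (1 - b / 2) = (a + b - 1) / 2 by ring, one_rpow,
        mul_rpow (by norm_num) (by positivity), ← rpow_natCast σ₂ 2, ← rpow_mul hσ₂.le,
        show (a + b) / 2 = (a / 2 - 1) + (-(1 - b / 2)) + 2 by ring,
        rpow_add two_pos, rpow_add two_pos,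
        show σ₂ ^ b = σ₂ ^ ((2 : ℕ) : ℝ) * σ₂ ^ (((2 : ℕ) : ℝ) * -(1 - b / 2)) by
          rw [← rpow_add hσ₂]; congr 1; push_cast; ring]
      rw [show (2 : ℝ) ^ (2 : ℝ) = 4 by norm_num]
      field_simp
      ring
    rw [absMoment_eq_lintegral hσ₁ hσ₂ hb hb2, absMoment_eq_lintegral hσ₁ hσ₂ hb hb2, herr,
      ← lintegral_add_right _ (by fun_prop)]
    refine setLIntegral_mono' measurableSet_Ioi fun v hv => ?_
    have hv : 0 < v := hv
    have hsplit : ENNReal.ofReal (b / 2 * (Gamma (1 - b / 2))⁻¹ * (ρ ^ 2 * τ)) *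
          ENNReal.ofReal (v ^ (1 - b / 2 - 1) * (1 + 2 * σ₂ ^ 2 * v) ^ (-((a + 1) / 2))) =
        ENNReal.ofReal (b / 2 * (Gamma (1 - b / 2))⁻¹ * v ^ (-b / 2 - 1)) *
          ENNReal.ofReal (ρ ^ 2 * v * τ * (1 + 2 * σ₂ ^ 2 * v) ^ (-((a + 1) / 2))) := by
      rw [← ENNReal.ofReal_mul (by positivity), ← ENNReal.ofReal_mul (by positivity)]
      congr 1
      rw [show 1 - b / 2 - 1 = (-b / 2 - 1) + 1 by ring, rpow_add_one hv.ne']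
      ring
    rw [hsplit, ← mul_add]
    gcongr
    exact oneSubExpMoment_uncorrelated_le hσ₁ hσ₂ hρ ha ha1 hv.le
  · refine absMoment_two_le_of_forall_oneSubExpMoment_le fun v hv =>
      (oneSubExpMoment_uncorrelated_le hσ₁ hσ₂ hρ ha ha1 hv.le).trans ?_
    rw [mul_add, ← ENNReal.ofReal_mul hv.le]
    refine add_le_add (oneSubExpMoment_le_absMoment_two hσ₁ hσ₂ hv.le)
      (ENNReal.ofReal_le_ofReal ?_)
    have hle : (1 + 2 * σ₂ ^ 2 * v) ^ (-((a + 1) / 2)) ≤ 1 :=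
      rpow_le_one_of_one_le_of_nonpos (by nlinarith [mul_pos (pow_pos hσ₂ 2) hv]) (by linarith)
    refine (mul_le_of_le_one_right ?_ hle).trans_eq ?_
    · have : 0 < -a := by linarith
      positivity
    · rw [show (a + 2) / 2 = (a / 2 - 1) + 2 by ring, rpow_add two_pos,
        show (2 : ℝ) ^ (2 : ℝ) = 4 by norm_num, rpow_two,
        show (a + 2 - 1) / 2 = (a + 1) / 2 by ring]
      field_simp
      ring

theorem integrable_abs_rpow_mul_gaussian {σ a : ℝ} (hσ : 0 < σ) (ha : -1 < a) :
    Integrable fun x : ℝ => |x| ^ a * (√(2 * π * σ ^ 2))⁻¹ * exp (-x ^ 2 / (2 * σ ^ 2)) := by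
  have hIoi : IntegrableOn
      (fun x : ℝ => |x| ^ a * (√(2 * π * σ ^ 2))⁻¹ * exp (-x ^ 2 / (2 * σ ^ 2)))
      (Set.Ioi 0) := by
    have h := (integrableOn_rpow_mul_exp_neg_mul_sq (b := 1 / (2 * σ ^ 2)) (by positivity)
      ha).const_mul (√(2 * π * σ ^ 2))⁻¹
    refine IntegrableOn.congr_fun h (fun x hx => ?_) measurableSet_Ioi
    have hx : 0 < x := hx
    simp only [abs_of_pos hx]
    rw [show -x ^ 2 / (2 * σ ^ 2) = -(1 / (2 * σ ^ 2)) * x ^ 2 by ring]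
    ring
  rw [← integrableOn_univ, ← Set.Iio_union_Ici (a := (0 : ℝ)), integrableOn_union,
    integrableOn_Ici_iff_integrableOn_Ioi]
  refine ⟨?_, hIoi⟩
  rw [← (Measure.measurePreserving_neg (volume : Measure ℝ)).integrableOn_comp_preimage
    (Homeomorph.neg ℝ).measurableEmbedding]
  simpa only [Function.comp_def, neg_sq, abs_neg, Set.neg_preimage, Set.neg_Iio, neg_zero]
    using hIoi

theorem gaussDensity2_zero {σ₁ σ₂ : ℝ} (hσ₁ : 0 < σ₁) (hσ₂ : 0 < σ₂) (x y : ℝ) :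
    gaussDensity2 σ₁ σ₂ 0 x y =
      ((√(2 * π * σ₁ ^ 2))⁻¹ * exp (-x ^ 2 / (2 * σ₁ ^ 2))) *
        ((√(2 * π * σ₂ ^ 2))⁻¹ * exp (-y ^ 2 / (2 * σ₂ ^ 2))) := by
  have hs : √(2 * π * σ₁ ^ 2) * √(2 * π * σ₂ ^ 2) = 2 * π * σ₁ * σ₂ := by
    rw [← sqrt_mul (by positivity), sqrt_eq_iff_mul_self_eq_of_pos (by positivity)]
    ring
  rw [mul_mul_mul_comm, ← exp_add, ← mul_inv, hs, gaussDensity2]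
  simp only [ne_eq, OfNat.ofNat_ne_zero, not_false_eq_true, zero_pow, sub_zero, sqrt_one, mul_one,
    mul_zero, zero_mul, zero_div]
  congr 2
  field_simp
  ring

theorem integrable_and_E2_zero {σ₁ σ₂ a b : ℝ} (hσ₁ : 0 < σ₁) (hσ₂ : 0 < σ₂)
    (ha : -1 < a) (hb : -1 < b) :
    Integrable (fun q : ℝ × ℝ => |q.1| ^ a * |q.2| ^ b * gaussDensity2 σ₁ σ₂ 0 q.1 q.2) ∧
      E2 σ₁ σ₂ 0 a b = E1 σ₁ a * E1 σ₂ b := by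
  have e : (fun q : ℝ × ℝ => |q.1| ^ a * |q.2| ^ b * gaussDensity2 σ₁ σ₂ 0 q.1 q.2) =
      fun q => (|q.1| ^ a * (√(2 * π * σ₁ ^ 2))⁻¹ * exp (-q.1 ^ 2 / (2 * σ₁ ^ 2))) *
        (|q.2| ^ b * (√(2 * π * σ₂ ^ 2))⁻¹ * exp (-q.2 ^ 2 / (2 * σ₂ ^ 2))) := by
    funext q
    rw [gaussDensity2_zero hσ₁ hσ₂]
    ring
  constructor
  · rw [e]
    exact (integrable_abs_rpow_mul_gaussian hσ₁ ha).mul_prod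
      (integrable_abs_rpow_mul_gaussian hσ₂ hb)
  · rw [E2, e, E1, E1, Measure.volume_eq_prod]
    exact integral_prod_mul
      (fun x : ℝ => |x| ^ a * (√(2 * π * σ₁ ^ 2))⁻¹ * exp (-x ^ 2 / (2 * σ₁ ^ 2)))
      (fun y : ℝ => |y| ^ b * (√(2 * π * σ₂ ^ 2))⁻¹ * exp (-y ^ 2 / (2 * σ₂ ^ 2)))

theorem E2_eq_toReal_absMoment {σ₁ σ₂ : ℝ} (hσ₁ : 0 < σ₁) (hσ₂ : 0 < σ₂) (ρ a b : ℝ) :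
    E2 σ₁ σ₂ ρ a b = (absMoment σ₁ σ₂ ρ a b).toReal := by
  have hm := measurable_gaussDensity2 σ₁ σ₂ ρ
  refine integral_eq_lintegral_of_nonneg_ae (ae_of_all _ fun q => ?_)
    (Measurable.aestronglyMeasurable (by fun_prop))
  have := gaussDensity2_nonneg hσ₁ hσ₂ ρ q.1 q.2
  simp only [Pi.zero_apply]
  positivity

theorem opposite_gpi_quantitative_lower (σ₁ σ₂ ρ α₁ α₂ : ℝ)
    (hσ₁ : 0 < σ₁) (hσ₂ : 0 < σ₂) (hρ : ρ ∈ Set.Ioo (-1 : ℝ) 1)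
    (hα₁ : α₁ ∈ Set.Ioo (-1 : ℝ) 0) (hα₂ : α₂ ∈ Set.Ioc (0 : ℝ) 2)
    (hsum : 1 < α₁ + α₂) :
    E2 σ₁ σ₂ ρ α₁ α₂ - E1 σ₁ α₁ * E1 σ₂ α₂ ≥
      2 ^ ((α₁ + α₂) / 2) * α₁ * α₂ * σ₁ ^ α₁ * σ₂ ^ α₂ * ρ ^ 2 / (2 * π) *
        Real.Gamma ((α₁ + 1) / 2) * Real.Gamma ((α₂ + 1) / 2) *
        (Real.Gamma (3 / 2) * Real.Gamma ((α₁ + α₂ - 1) / 2) /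
          (Real.Gamma ((α₁ + 1) / 2) * Real.Gamma ((α₂ + 1) / 2))) := by
  obtain ⟨ha1, ha⟩ := hα₁
  obtain ⟨hb, hb2⟩ := hα₂
  have hρ2 : ρ ^ 2 < 1 := (sq_lt_one_iff_abs_lt_one ρ).2 (abs_lt.2 hρ)
  obtain ⟨hint, hE⟩ := integrable_and_E2_zero hσ₁ hσ₂ ha1 (show -1 < α₂ by linarith)
  have hfin0 : absMoment σ₁ σ₂ 0 α₁ α₂ ≠ ∞ := hint.lintegral_lt_top.ne
  have hfin : absMoment σ₁ σ₂ ρ α₁ α₂ ≠ ∞ :=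
    ne_top_of_le_ne_top hfin0 (absMoment_le_uncorrelated hσ₁ hσ₂ hρ2 ha hb hb2)
  have hΓa := Gamma_pos_of_pos (show 0 < (α₁ + 1) / 2 by linarith)
  have hΓb := Gamma_pos_of_pos (show 0 < (α₂ + 1) / 2 by linarith)
  have hΓs := Gamma_pos_of_pos (show 0 < (α₁ + α₂ - 1) / 2 by linarith)
  have hΓ3 := Gamma_pos_of_pos (show (0 : ℝ) < 3 / 2 by norm_num)
  have hΓ3sq : Gamma (3 / 2) ^ 2 = π / 4 := by
    rw [show (3 / 2 : ℝ) = 1 / 2 + 1 by norm_num, Gamma_add_one (by norm_num),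
      Gamma_one_half_eq, mul_pow, sq_sqrt pi_pos.le]
    ring
  have herr : 0 ≤ -(α₁ * α₂ * ρ ^ 2 * σ₁ ^ α₁ * σ₂ ^ α₂ * 2 ^ ((α₁ + α₂) / 2) *
        Gamma ((α₁ + α₂ - 1) / 2) / (8 * Gamma (3 / 2))) := by
    have : 0 ≤ (-α₁) * α₂ * ρ ^ 2 * σ₁ ^ α₁ * σ₂ ^ α₂ * 2 ^ ((α₁ + α₂) / 2) *
        Gamma ((α₁ + α₂ - 1) / 2) / (8 * Gamma (3 / 2)) := by
      have : 0 < -α₁ := by linarith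
      positivity
    refine this.trans_eq (by ring)
  have key := ENNReal.toReal_mono (ENNReal.add_ne_top.2 ⟨hfin, ENNReal.ofReal_ne_top⟩)
    (absMoment_uncorrelated_le hσ₁ hσ₂ hρ2 ha ha1 hb hb2 hsum)
  rw [ENNReal.toReal_add hfin ENNReal.ofReal_ne_top, ENNReal.toReal_ofReal herr,
    ← E2_eq_toReal_absMoment hσ₁ hσ₂, ← E2_eq_toReal_absMoment hσ₁ hσ₂, hE] at key
  have hrhs : 2 ^ ((α₁ + α₂) / 2) * α₁ * α₂ * σ₁ ^ α₁ * σ₂ ^ α₂ * ρ ^ 2 / (2 * π) *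
        Gamma ((α₁ + 1) / 2) * Gamma ((α₂ + 1) / 2) *
        (Gamma (3 / 2) * Gamma ((α₁ + α₂ - 1) / 2) /
          (Gamma ((α₁ + 1) / 2) * Gamma ((α₂ + 1) / 2))) =
      α₁ * α₂ * ρ ^ 2 * σ₁ ^ α₁ * σ₂ ^ α₂ * 2 ^ ((α₁ + α₂) / 2) *
        Gamma ((α₁ + α₂ - 1) / 2) / (8 * Gamma (3 / 2)) := by
    rw [show π = 4 * Gamma (3 / 2) ^ 2 by linarith]
    field_simp
    ring
  rw [hrhs]
  linarith
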